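/- Flatness of a module is flat-local: let B be a commutative semiring, (C_i)_{i ∈ ι} a faithful family of flat commutative B-algebras, and N a B-module. Then N is flat as a B-module if and only if, for every i ∈ ι, the C_i-module C_i ⊗[B] N is flat as a C_i-module. -/

import Mathlib

open TensorProduct

universe u

/-- A module `M` over a commutative semiring `R` is *flat* if for every pair of `R`-linear
maps `f g : N → P`, the map `M ⊗ E → M ⊗ N` induced by the inclusion of the equalizer
submodule `E = {x ∈ N | f x = g x}` is injective with range the equalizer of
`id_M ⊗ f` and `id_M ⊗ g`. -/
def Module.IsSemiringFlat (R M : Type u) [CommSemiring R] [AddCommMonoid M]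
    [Module R M] : Prop :=
  ∀ (N P : Type u) [AddCommMonoid N] [Module R N] [AddCommMonoid P] [Module R P]
    (f g : N →ₗ[R] P),
    Function.Injective (LinearMap.lTensor M (LinearMap.eqLocus f g).subtype) ∧
      LinearMap.range (LinearMap.lTensor M (LinearMap.eqLocus f g).subtype) =
        LinearMap.eqLocus (LinearMap.lTensor M f) (LinearMap.lTensor M g)

/-- A family `(C i)` of `R`-algebras is *faithful* if a map of `R`-modules is bijective
as soon as all the maps obtained by tensoring with the `C i` are bijective. -/
def Algebra.IsFaithfulFamily (R : Type u) [CommSemiring R] {ι : Type u} (C : ι → Type u)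
    [∀ i, CommSemiring (C i)] [∀ i, Algebra R (C i)] : Prop :=
  ∀ (M P : Type u) [AddCommMonoid M] [Module R M] [AddCommMonoid P] [Module R P]
    (g : M →ₗ[R] P),
    (∀ i, Function.Bijective (LinearMap.lTensor (C i) g)) → Function.Bijective g

/-- `e` exhibits `E` as the equalizer of `f` and `g` in the category of types. -/
def IsEqualizerMap {E X Y : Type*} (e : E → X) (f g : X → Y) : Prop :=
  Function.Injective e ∧ ∀ x, x ∈ Set.range e ↔ f x = g x

theorem IsEqualizerMap.of_bijective {E X Y E' X' Y' : Type*} {e : E → X} {f g : X → Y}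
    {e' : E' → X'} {f' g' : X' → Y'} (h : IsEqualizerMap e f g)
    {a : E' → E} {b : X' → X} {c : Y' → Y} (ha : Function.Bijective a)
    (hb : Function.Bijective b) (hc : Function.Injective c)
    (he : ∀ x, b (e' x) = e (a x)) (hf : ∀ x, c (f' x) = f (b x))
    (hg : ∀ x, c (g' x) = g (b x)) : IsEqualizerMap e' f' g' := by
  refine ⟨fun x y hxy => ha.1 (h.1 ?_), fun x => ?_⟩
  · rw [← he, ← he, hxy]
  · rw [← hc.eq_iff, hf, hg, ← h.2]
    constructor
    · rintro ⟨y, rfl⟩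
      exact ⟨a y, (he y).symm⟩
    · rintro ⟨y, hy⟩
      obtain ⟨z, rfl⟩ := ha.2 y
      exact ⟨z, hb.1 ((he z).trans hy)⟩

theorem IsEqualizerMap.bijective_of_comp {E K X Y : Type*} {e : E → X} {k : K → X}
    {f g : X → Y} (he : IsEqualizerMap e f g) (hk : IsEqualizerMap k f g) {a : E → K}
    (ha : ∀ x, k (a x) = e x) : Function.Bijective a := by
  refine ⟨fun x y hxy => he.1 ?_, fun y => ?_⟩
  · rw [← ha, ← ha, hxy]
  · obtain ⟨x, hx⟩ := (he.2 _).2 ((hk.2 _).1 ⟨y, rfl⟩)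
    exact ⟨x, hk.1 ((ha x).trans hx)⟩

section

variable {R : Type u} [CommSemiring R]

theorem isEqualizerMap_eqLocus_subtype {X Y : Type u} [AddCommMonoid X] [Module R X]
    [AddCommMonoid Y] [Module R Y] (f g : X →ₗ[R] Y) :
    IsEqualizerMap (LinearMap.eqLocus f g).subtype f g :=
  ⟨Subtype.val_injective, fun x => ⟨by rintro ⟨y, rfl⟩; exact y.2, fun h => ⟨⟨x, h⟩, rfl⟩⟩⟩

theorem Module.isSemiringFlat_iff_isEqualizerMap {M : Type u} [AddCommMonoid M] [Module R M] :
    Module.IsSemiringFlat R M ↔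
      ∀ (X Y : Type u) [AddCommMonoid X] [Module R X] [AddCommMonoid Y] [Module R Y]
        (f g : X →ₗ[R] Y),
        IsEqualizerMap (LinearMap.lTensor M (LinearMap.eqLocus f g).subtype)
          (LinearMap.lTensor M f) (LinearMap.lTensor M g) :=
  ⟨fun h X Y _ _ _ _ f g => ⟨(h X Y f g).1, fun x => SetLike.ext_iff.1 (h X Y f g).2 x⟩,
    fun h X Y _ _ _ _ f g => ⟨(h X Y f g).1, SetLike.ext (h X Y f g).2⟩⟩

theorem Module.IsSemiringFlat.lTensor_isEqualizerMap {M : Type u} [AddCommMonoid M]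
    [Module R M] (hM : Module.IsSemiringFlat R M) {E X Y : Type u}
    [AddCommMonoid E] [Module R E] [AddCommMonoid X] [Module R X] [AddCommMonoid Y] [Module R Y]
    {e : E →ₗ[R] X} {f g : X →ₗ[R] Y} (h : IsEqualizerMap e f g) :
    IsEqualizerMap (LinearMap.lTensor M e) (LinearMap.lTensor M f) (LinearMap.lTensor M g) := by
  let a : E →ₗ[R] LinearMap.eqLocus f g := e.codRestrict _ fun x => (h.2 _).1 ⟨x, rfl⟩
  have ha : Function.Bijective a :=
    h.bijective_of_comp (isEqualizerMap_eqLocus_subtype f g) fun _ => rfl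
  refine (Module.isSemiringFlat_iff_isEqualizerMap.1 hM X Y f g).of_bijective
    (a := (LinearEquiv.ofBijective a ha).lTensor M) (b := id) (c := id)
    (LinearEquiv.bijective _) Function.bijective_id Function.injective_id
    (fun x => ?_) (fun _ => rfl) (fun _ => rfl)
  induction x with
  | zero => simp
  | tmul m y => rfl
  | add x y hx hy => simp only [map_add, id] at hx hy ⊢; rw [hx, hy]

variable {A : Type u} [CommSemiring A] [Algebra R A]

theorem cancelBaseChange_comm_lTensor {N X Y : Type u} [AddCommMonoid N] [Module R N]
    [AddCommMonoid X] [Module R X] [Module A X] [IsScalarTower R A X]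
    [AddCommMonoid Y] [Module R Y] [Module A Y] [IsScalarTower R A Y]
    (f : X →ₗ[A] Y) (z : (A ⊗[R] N) ⊗[A] X) :
    AlgebraTensorModule.cancelBaseChange R A A Y N
        (TensorProduct.comm A (A ⊗[R] N) Y (LinearMap.lTensor (A ⊗[R] N) f z)) =
      LinearMap.rTensor N (f.restrictScalars R)
        (AlgebraTensorModule.cancelBaseChange R A A X N
          (TensorProduct.comm A (A ⊗[R] N) X z)) := by
  induction z with
  | zero => simp
  | add x y hx hy => simp only [map_add, hx, hy]
  | tmul w x =>
    induction w with
    | zero => simp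
    | add v w hv hw => simp only [TensorProduct.add_tmul, map_add, hv, hw]
    | tmul a n => simp

theorem distribBaseChange_lTensor_lTensor {N X Y : Type u} [AddCommMonoid N] [Module R N]
    [AddCommMonoid X] [Module R X] [AddCommMonoid Y] [Module R Y]
    (f : X →ₗ[R] Y) (z : A ⊗[R] (N ⊗[R] X)) :
    AlgebraTensorModule.distribBaseChange R A N Y
        (LinearMap.lTensor A (LinearMap.lTensor N f) z) =
      LinearMap.lTensor (A ⊗[R] N) (f.baseChange A)
        (AlgebraTensorModule.distribBaseChange R A N X z) := by
  induction z with
  | zero => simp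
  | add x y hx hy => simp only [map_add, hx, hy]
  | tmul a w =>
    induction w with
    | zero => simp
    | add v w hv hw => simp only [TensorProduct.tmul_add, map_add, hv, hw]
    | tmul n x => simp

theorem Module.IsSemiringFlat.baseChange {N : Type u} [AddCommMonoid N] [Module R N]
    (hN : Module.IsSemiringFlat R N) : Module.IsSemiringFlat A (A ⊗[R] N) := by
  rw [Module.isSemiringFlat_iff_isEqualizerMap]
  intro X Y _ _ _ _ f g
  let _ : Module R X := Module.compHom X (algebraMap R A)
  let _ : Module R Y := Module.compHom Y (algebraMap R A)
  have : IsScalarTower R A X := IsScalarTower.of_algebraMap_smul fun _ _ => rfl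
  have : IsScalarTower R A Y := IsScalarTower.of_algebraMap_smul fun _ _ => rfl
  have h := hN.lTensor_isEqualizerMap (e := (LinearMap.eqLocus f g).subtype.restrictScalars R)
    (f := f.restrictScalars R) (g := g.restrictScalars R) (isEqualizerMap_eqLocus_subtype f g)
  have key : ∀ {X Y : Type u} [AddCommMonoid X] [AddCommMonoid Y] [Module R X] [Module R Y]
      [Module A X] [Module A Y] [IsScalarTower R A X] [IsScalarTower R A Y] (k : X →ₗ[A] Y)
      (z : (A ⊗[R] N) ⊗[A] X),
      TensorProduct.comm R Y N (AlgebraTensorModule.cancelBaseChange R A A Y N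
        (TensorProduct.comm A (A ⊗[R] N) Y (LinearMap.lTensor (A ⊗[R] N) k z))) =
      LinearMap.lTensor N (k.restrictScalars R) (TensorProduct.comm R X N
        (AlgebraTensorModule.cancelBaseChange R A A X N
          (TensorProduct.comm A (A ⊗[R] N) X z))) := by
    intro X Y _ _ _ _ _ _ _ _ k z
    rw [cancelBaseChange_comm_lTensor, ← LinearMap.comm_comp_rTensor_comp_comm_eq]
    simp
  have bij : ∀ (X : Type u) [AddCommMonoid X] [Module R X] [Module A X] [IsScalarTower R A X],
      Function.Bijective fun z : (A ⊗[R] N) ⊗[A] X => TensorProduct.comm R X N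
        (AlgebraTensorModule.cancelBaseChange R A A X N
          (TensorProduct.comm A (A ⊗[R] N) X z)) := fun X _ _ _ _ =>
    (TensorProduct.comm R X N).bijective.comp
      ((AlgebraTensorModule.cancelBaseChange R A A X N).bijective.comp
        (TensorProduct.comm A (A ⊗[R] N) X).bijective)
  exact h.of_bijective (bij _) (bij X) (bij Y).1 (key _) (key f) (key g)

theorem Module.IsSemiringFlat.lTensor_lTensor_isEqualizerMap {N : Type u} [AddCommMonoid N]
    [Module R N] (hA : Module.IsSemiringFlat R A) (hN : Module.IsSemiringFlat A (A ⊗[R] N))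
    {E X Y : Type u} [AddCommMonoid E] [Module R E] [AddCommMonoid X] [Module R X]
    [AddCommMonoid Y] [Module R Y] {e : E →ₗ[R] X} {f g : X →ₗ[R] Y}
    (h : IsEqualizerMap e f g) :
    IsEqualizerMap (LinearMap.lTensor A (LinearMap.lTensor N e))
      (LinearMap.lTensor A (LinearMap.lTensor N f))
      (LinearMap.lTensor A (LinearMap.lTensor N g)) :=
  (hN.lTensor_isEqualizerMap (e := e.baseChange A) (f := f.baseChange A) (g := g.baseChange A)
      (hA.lTensor_isEqualizerMap h)).of_bijective
    (AlgebraTensorModule.distribBaseChange R A N E).bijective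
    (AlgebraTensorModule.distribBaseChange R A N X).bijective
    (AlgebraTensorModule.distribBaseChange R A N Y).injective
    (distribBaseChange_lTensor_lTensor e) (distribBaseChange_lTensor_lTensor f)
    (distribBaseChange_lTensor_lTensor g)

end

/-- Flatness of a module is flat-local: given a faithful family of flat `B`-algebras
`C i`, a `B`-module `N` is flat iff each `C i ⊗[B] N` is flat as a `C i`-module. -/
theorem module_flat_iff_of_faithful_flat_family (B : Type u) [CommSemiring B]
    {ι : Type u} (C : ι → Type u) [∀ i, CommSemiring (C i)] [∀ i, Algebra B (C i)]
    (hfaith : Algebra.IsFaithfulFamily B C)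
    (hflat : ∀ i, Module.IsSemiringFlat B (C i))
    (N : Type u) [AddCommMonoid N] [Module B N] :
    Module.IsSemiringFlat B N ↔ ∀ i, Module.IsSemiringFlat (C i) ((C i) ⊗[B] N) := by
  refine ⟨fun hN i => hN.baseChange, fun h => ?_⟩
  rw [Module.isSemiringFlat_iff_isEqualizerMap]
  intro X Y _ _ _ _ f g
  have hE := isEqualizerMap_eqLocus_subtype f g
  have hK := isEqualizerMap_eqLocus_subtype (LinearMap.lTensor N f) (LinearMap.lTensor N g)
  let a : N ⊗[B] LinearMap.eqLocus f g →ₗ[B]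
      LinearMap.eqLocus (LinearMap.lTensor N f) (LinearMap.lTensor N g) :=
    (LinearMap.lTensor N (LinearMap.eqLocus f g).subtype).codRestrict _ fun x => by
      rw [LinearMap.mem_eqLocus, ← LinearMap.lTensor_comp_apply, ← LinearMap.lTensor_comp_apply]
      congr 2
      ext y
      exact y.2
  have ha : Function.Bijective a := hfaith _ _ a fun i =>
    ((hflat i).lTensor_lTensor_isEqualizerMap (h i) hE).bijective_of_comp
      ((hflat i).lTensor_isEqualizerMap hK) fun x =>
        (LinearMap.lTensor_comp_apply (C i) _ a x).symm
  exact hK.of_bijective ha Function.bijective_id Function.injective_id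
    (fun _ => rfl) (fun _ => rfl) (fun _ => rfl)
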